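/- Let A = ⊕_{i∈ℤ} A_i be a ℤ-graded finitely generated normal integral domain over ℂ of Krull dimension 2 with A_1 ≠ 0 and A_{-1} ≠ 0 (hyperbolic), and let ∂ be a nonzero homogeneous locally nilpotent ℂ-derivation of A of degree 0. Then there is an isomorphism of ℂ-algebras A ≅ ℂ[z, v, v⁻¹] (the ring of Laurent polynomials in v over a polynomial ring in z) which is graded with deg z = 0 and deg v = d for some d ≥ 1, and under which ∂ corresponds to the derivation ∂/∂z. -/

import Mathlib

/-- A `ℂ`-derivation `D` of a commutative `ℂ`-algebra `A` is locally nilpotent if for every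
`f ∈ A` there is `n` with `D^[n] f = 0`. -/
def Derivation.IsLocallyNilpotent {A : Type*} [CommRing A] [Algebra ℂ A]
    (D : Derivation ℂ A A) : Prop :=
  ∀ f : A, ∃ n : ℕ, (⇑D)^[n] f = 0

open Polynomial

section Dimension

open Cardinal

/-- An injective integral extension of commutative rings does not lower the Krull dimension. -/
theorem ringKrullDim_le_of_isIntegral_of_injective {R S : Type*} [CommRing R] [CommRing S]
    [Algebra R S] [Algebra.IsIntegral R S] (hinj : Function.Injective (algebraMap R S)) :
    ringKrullDim R ≤ ringKrullDim S := by
  refine iSup_le fun l ↦ ?_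
  obtain ⟨Q, -, hQ, hQl⟩ := Ideal.exists_ideal_over_prime_of_isIntegral l.head.asIdeal
    (⊥ : Ideal S) (by
      rw [← RingHom.ker_eq_comap_bot, (RingHom.injective_iff_ker_eq_bot _).1 hinj]
      exact bot_le)
  have : Q.LiesOver l.head.asIdeal := ⟨hQl.symm⟩
  obtain ⟨L, hL, -⟩ := Ideal.exists_ltSeries_of_hasGoingUp l Q
  rw [← hL]
  exact Order.LTSeries.length_le_krullDim L

/-- The transcendence degree of a finitely generated domain is at most its Krull dimension. -/
theorem Algebra.trdeg_le_of_ringKrullDim_le {k A : Type*} [Field k] [CommRing A] [IsDomain A]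
    [Algebra k A] [Algebra.FiniteType k A] {n : ℕ} (h : ringKrullDim A ≤ n) :
    Algebra.trdeg k A ≤ n := by
  obtain ⟨s, g, hg, hint⟩ := exists_integral_inj_algHom_of_fg k A
  algebraize [g.toRingHom]
  have : IsScalarTower k (MvPolynomial (Fin s) k) A :=
    IsScalarTower.of_algebraMap_eq fun x ↦ (g.commutes x).symm
  have : Algebra.IsIntegral (MvPolynomial (Fin s) k) A := ⟨hint⟩
  have : FaithfulSMul (MvPolynomial (Fin s) k) A :=
    (faithfulSMul_iff_algebraMap_injective _ _).2 hg
  have hs : s ≤ n := by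
    have h1 := (ringKrullDim_le_of_isIntegral_of_injective
      (R := MvPolynomial (Fin s) k) (S := A) hg).trans h
    rw [MvPolynomial.ringKrullDim_of_isNoetherianRing, ringKrullDim_eq_zero_of_field, zero_add,
      Nat.card_fin] at h1
    exact_mod_cast h1
  have h2 := lift_trdeg_add_eq k (MvPolynomial (Fin s) k) A
  rw [trdeg_eq_zero (R := MvPolynomial (Fin s) k) (A := A),
    MvPolynomial.trdeg_of_isDomain] at h2
  simp only [mk_fin, lift_natCast, lift_zero, add_zero] at h2
  have h3 : Algebra.trdeg k A = s := by
    rw [← lift_inj, ← h2, lift_natCast]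
  rw [h3]
  exact_mod_cast hs

end Dimension

/-- An element of a domain that is algebraic over an algebraically closed field `k` is in `k`. -/
theorem IsAlgClosed.exists_algebraMap_eq_of_isAlgebraic {k A : Type*} [Field k] [IsAlgClosed k]
    [CommRing A] [IsDomain A] [Algebra k A] {t : A} (ht : IsAlgebraic k t) :
    ∃ c : k, algebraMap k A c = t :=
  minpoly.mem_range_of_degree_eq_one k t
    (IsAlgClosed.degree_eq_one_of_irreducible k (minpoly.irreducible ht.isIntegral))

/-- Over a field of characteristic zero every polynomial has an antiderivative. -/
theorem Polynomial.exists_derivative_eq {k : Type*} [Field k] [CharZero k] (p : k[X]) :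
    ∃ q : k[X], derivative q = p := by
  induction p using Polynomial.induction_on' with
  | add p q hp hq =>
    obtain ⟨p', rfl⟩ := hp
    obtain ⟨q', rfl⟩ := hq
    exact ⟨p' + q', derivative_add⟩
  | monomial n c =>
    refine ⟨monomial (n + 1) (c / (n + 1)), ?_⟩
    have : (n : k) + 1 ≠ 0 := by exact_mod_cast n.succ_ne_zero
    rw [derivative_monomial]
    simp [this]

/-- An element is transcendental over a subalgebra `S` if it is not a root of any nonzero polynomial
with coefficients in `S`. -/
theorem Subalgebra.transcendental_of_eval_eq_zero {R A : Type*} [CommRing R] [CommRing A]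
    [Algebra R A] {S : Subalgebra R A} {a : A}
    (h : ∀ p : A[X], (∀ i, p.coeff i ∈ S) → p.eval a = 0 → p = 0) : Transcendental S a := by
  rw [transcendental_iff]
  intro p hp
  refine (Polynomial.map_eq_zero_iff (f := algebraMap S A) Subtype.val_injective).1 (h _ ?_ ?_)
  · intro i
    rw [coeff_map]
    exact (p.coeff i).2
  · rwa [eval_map_algebraMap]

namespace Derivation

section

variable {R A : Type*} [CommRing R] [CommRing A] [Algebra R A] (D : Derivation R A A)

theorem map_eval_of_coeff {p : A[X]} (hp : ∀ i, D (p.coeff i) = 0) (z : A) :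
    D (p.eval z) = p.derivative.eval z * D z := by
  rw [derivative_eval, eval_eq_sum, Polynomial.sum, Polynomial.sum, map_sum, Finset.sum_mul]
  refine Finset.sum_congr rfl fun i _ ↦ ?_
  rw [leibniz, hp, leibniz_pow]
  simp only [smul_eq_mul, nsmul_eq_mul]
  ring

/-- An element not killed by `D` is transcendental over the kernel of `D`. -/
theorem eq_zero_of_eval_eq_zero [IsDomain A] [CharZero A] {z : A} (hz : D z ≠ 0) {p : A[X]}
    (hp : ∀ i, D (p.coeff i) = 0) (h : p.eval z = 0) : p = 0 := by
  induction hn : p.natDegree using Nat.strong_induction_on generalizing p with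
  | _ n ih =>
    have h1 : p.derivative.eval z = 0 := by
      have := D.map_eval_of_coeff hp z
      rw [h, map_zero] at this
      exact (mul_eq_zero.1 this.symm).resolve_right hz
    have h0 : p.natDegree = 0 := by
      by_contra h0
      have := ih _ (hn ▸ natDegree_derivative_lt h0) (p := p.derivative) (fun i ↦ by
        rw [coeff_derivative, leibniz, hp, ← Nat.cast_succ, map_natCast]; simp) h1 rfl
      exact h0 (derivative_eq_zero.1 this)
    rw [eq_C_of_natDegree_eq_zero h0] at h ⊢
    rw [eval_C] at h
    rw [h, C_0]

/-- The kernel of a derivation, as a subalgebra. -/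
def kerSubalgebra : Subalgebra R A where
  carrier := {x | D x = 0}
  mul_mem' {x y} hx hy := by
    simp only [Set.mem_ofPred_eq] at *
    rw [leibniz, hx, hy, smul_zero, smul_zero, add_zero]
  add_mem' {x y} hx hy := by
    simp only [Set.mem_ofPred_eq] at *
    rw [map_add, hx, hy, add_zero]
  algebraMap_mem' r := D.map_algebraMap r

theorem map_units_zpow_eq_zero {u : Aˣ} (hu : D u = 0) (n : ℤ) : D (u ^ n : Aˣ) = 0 := by
  have hpow (v : Aˣ) (hv : D v = 0) (n : ℕ) : D (v ^ n : Aˣ) = 0 := by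
    rw [Units.val_pow_eq_pow_val, leibniz_pow, hv, smul_zero, smul_zero]
  have hinv : D (u⁻¹ : Aˣ) = 0 := by
    have h := D.leibniz (u : A) (u⁻¹ : Aˣ)
    rw [Units.mul_inv, map_one_eq_zero, hu, smul_zero, add_zero, smul_eq_mul] at h
    exact (Units.mul_right_eq_zero u).1 h.symm
  obtain ⟨m, rfl | rfl⟩ := n.eq_nat_or_neg
  · rw [zpow_natCast]
    exact hpow u hu m
  · rw [zpow_neg, zpow_natCast, ← inv_pow]
    exact hpow _ hinv m

end

section LocallyNilpotent

variable {A : Type*} [CommRing A] [Algebra ℂ A] {D : Derivation ℂ A A}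

/-- A nonzero submodule stable under a locally nilpotent derivation meets its kernel. -/
theorem IsLocallyNilpotent.exists_mem_ne_zero (hD : D.IsLocallyNilpotent) {M : Submodule ℂ A}
    (hM : M ≠ ⊥) (hDM : ∀ a ∈ M, D a ∈ M) : ∃ a ∈ M, a ≠ 0 ∧ D a = 0 := by
  obtain ⟨f, hf, hf0⟩ := Submodule.exists_mem_ne_zero_of_ne_bot hM
  obtain ⟨n, hn⟩ := hD f
  induction n generalizing f with
  | zero => exact absurd hn hf0
  | succ n ih =>
    by_cases h : D f = 0
    · exact ⟨f, hf, hf0, h⟩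
    · exact ih _ (hDM f hf) h hn

/-- A locally nilpotent derivation that does not vanish on a stable submodule has there a local
slice. -/
theorem IsLocallyNilpotent.exists_localSlice (hD : D.IsLocallyNilpotent) {M : Submodule ℂ A}
    (hDM : ∀ a ∈ M, D a ∈ M) {f : A} (hf : f ∈ M) (hf0 : D f ≠ 0) :
    ∃ z ∈ M, D z ≠ 0 ∧ D (D z) = 0 := by
  obtain ⟨n, hn⟩ := hD f
  induction n generalizing f with
  | zero => exact absurd (by simpa using congrArg D hn) hf0
  | succ n ih =>
    by_cases h : D (D f) = 0
    · exact ⟨f, hf, hf0, h⟩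
    · exact ih (hDM f hf) h hn

/-- The slice theorem on a stable submodule: if `D z = 1` and the only elements of the submodule
killed by `D` are constants, then all its elements are polynomials in `z`. -/
theorem IsLocallyNilpotent.exists_aeval_eq (hD : D.IsLocallyNilpotent) {M : Submodule ℂ A}
    (hDM : ∀ a ∈ M, D a ∈ M) (hker : ∀ a ∈ M, D a = 0 → ∃ c : ℂ, algebraMap ℂ A c = a)
    {z : A} (hzM : ∀ p : ℂ[X], aeval z p ∈ M) (hz : D z = 1) {f : A} (hf : f ∈ M) :
    ∃ p : ℂ[X], aeval z p = f := by
  obtain ⟨n, hn⟩ := hD f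
  induction n generalizing f with
  | zero => exact ⟨0, by rw [map_zero]; exact hn.symm⟩
  | succ n ih =>
    obtain ⟨p, hp⟩ := ih (hDM f hf) hn
    obtain ⟨q, rfl⟩ := Polynomial.exists_derivative_eq p
    obtain ⟨c, hc⟩ := hker (f - aeval z q) (M.sub_mem hf (hzM q)) (by
      rw [map_sub, D.map_aeval, hz, smul_eq_mul, mul_one, hp, sub_self])
    exact ⟨q + C c, by rw [map_add, aeval_C, hc, add_sub_cancel]⟩

end LocallyNilpotent

end Derivation

section Units

variable {A : Type*} [CommRing A] [Algebra ℂ A]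

/-- The evaluation `ℂ[z, v, v⁻¹] → A` at an element `z` and a unit `u`. -/
noncomputable def laurentEval (z : A) (u : Aˣ) : LaurentPolynomial ℂ[X] →ₐ[ℂ] A :=
  { LaurentPolynomial.eval₂ (aeval z : ℂ[X] →ₐ[ℂ] A).toRingHom u with
    commutes' := fun c ↦ by
      have : algebraMap ℂ (LaurentPolynomial ℂ[X]) c = LaurentPolynomial.C (C c) := rfl
      simp [this] }

theorem laurentEval_C_mul_T (z : A) (u : Aˣ) (p : ℂ[X]) (i : ℤ) :
    laurentEval z u (LaurentPolynomial.C p * LaurentPolynomial.T i) =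
      aeval z p * (u ^ i : Aˣ) :=
  LaurentPolynomial.eval₂_C_mul_T _ _ _ _

theorem laurentEval_toLaurent (z : A) (u : Aˣ) (p : ℂ[X][X]) :
    laurentEval z u (toLaurent p) = (p.map (aeval z : ℂ[X] →ₐ[ℂ] A).toRingHom).eval ↑u :=
  (LaurentPolynomial.eval₂_toLaurent _ _ _).trans (eval_map _ _).symm

theorem GradedAlgebra.units_zpow_mem (𝒜 : ℤ → Submodule ℂ A) [GradedAlgebra 𝒜]
    {u : Aˣ} (hu : (u : A) ∈ 𝒜 1) (hu' : ((u⁻¹ : Aˣ) : A) ∈ 𝒜 (-1))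
    (i : ℤ) : ((u ^ i : Aˣ) : A) ∈ 𝒜 i := by
  obtain ⟨n, rfl | rfl⟩ := i.eq_nat_or_neg
  · rw [zpow_natCast, Units.val_pow_eq_pow_val]
    simpa using SetLike.pow_mem_graded n hu
  · rw [zpow_neg, zpow_natCast, ← inv_pow, Units.val_pow_eq_pow_val]
    simpa using SetLike.pow_mem_graded n hu'

theorem laurentEval_surjective (𝒜 : ℤ → Submodule ℂ A) [GradedAlgebra 𝒜] {z : A} {u : Aˣ}
    (hu : (u : A) ∈ 𝒜 1) (hu' : ((u⁻¹ : Aˣ) : A) ∈ 𝒜 (-1))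
    (hz : ∀ f ∈ 𝒜 0, ∃ p : ℂ[X], aeval z p = f) :
    Function.Surjective (laurentEval z u) := by
  intro f
  induction f using DirectSum.Decomposition.inductionOn 𝒜 with
  | zero => exact ⟨0, map_zero _⟩
  | add f g hf hg =>
    obtain ⟨f', rfl⟩ := hf
    obtain ⟨g', rfl⟩ := hg
    exact ⟨f' + g', map_add _ _ _⟩
  | @homogeneous i f =>
    obtain ⟨p, hp⟩ := hz (f * (u ^ (-i) : Aˣ)) (by
      simpa using SetLike.mul_mem_graded f.2 (GradedAlgebra.units_zpow_mem 𝒜 hu hu' (-i)))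
    refine ⟨LaurentPolynomial.C p * LaurentPolynomial.T i, ?_⟩
    rw [laurentEval_C_mul_T, hp, mul_assoc, ← Units.val_mul, ← zpow_add, neg_add_cancel, zpow_zero,
      Units.val_one, mul_one]

end Units

section Graded

variable {A : Type*} [CommRing A] [IsDomain A] [Algebra ℂ A]
  (𝒜 : ℤ → Submodule ℂ A) [GradedAlgebra 𝒜]

/-- A nonzero element of degree one is transcendental over the degree zero part. -/
theorem GradedAlgebra.eq_zero_of_eval_eq_zero {a : A} (ha : a ∈ 𝒜 1) (ha0 : a ≠ 0) {p : A[X]}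
    (hp : ∀ i, p.coeff i ∈ 𝒜 0) (h : p.eval a = 0) : p = 0 := by
  have hmem (i : ℕ) : p.coeff i * a ^ i ∈ 𝒜 i := by
    simpa using SetLike.mul_mem_graded (hp i) (SetLike.pow_mem_graded i ha)
  ext n
  have h1 := congrArg (GradedRing.proj 𝒜 n) h
  rw [eval_eq_sum_range, map_sum, map_zero] at h1
  simp only [GradedRing.proj_apply] at h1
  by_cases hn : n ∈ Finset.range (p.natDegree + 1)
  · rw [Finset.sum_eq_single_of_mem n hn fun i _ hi ↦
      DirectSum.decompose_of_mem_ne 𝒜 (hmem i) (by exact_mod_cast hi),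
      DirectSum.decompose_of_mem_same 𝒜 (hmem n)] at h1
    exact (mul_eq_zero.1 h1).resolve_right (pow_ne_zero _ ha0)
  · rw [coeff_zero]
    exact coeff_eq_zero_of_natDegree_lt (by simpa [Nat.lt_succ_iff] using hn)

/-- If `a` is homogeneous of degree one and killed by `D`, and `D` does not vanish on `z`, then in
a domain of dimension two every element of degree zero killed by `D` is constant. -/
theorem GradedAlgebra.exists_algebraMap_eq_of_mem_ker [Algebra.FiniteType ℂ A]
    (hdim : ringKrullDim A ≤ 2) {D : Derivation ℂ A A} {a z t : A} (ha : a ∈ 𝒜 1) (ha0 : a ≠ 0)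
    (hDa : D a = 0) (hz : D z ≠ 0) (ht : t ∈ 𝒜 0) (hDt : D t = 0) :
    ∃ c : ℂ, algebraMap ℂ A c = t := by
  have : CharZero A := charZero_of_injective_algebraMap (algebraMap ℂ A).injective
  refine IsAlgClosed.exists_algebraMap_eq_of_isAlgebraic (by_contra fun htr ↦ ?_)
  have h1 : AlgebraicIndependent ℂ (fun _ : Unit ↦ t) :=
    (algebraicIndependent_unique_type_iff).2 htr
  have h2 := (h1.option_iff_transcendental a).2
    (Subalgebra.transcendental_of_eval_eq_zero fun p hp h ↦ by
      have hle : Algebra.adjoin ℂ (Set.range fun _ : Unit ↦ t) ≤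
          SetLike.GradeZero.subalgebra 𝒜 :=
        Algebra.adjoin_le (by rintro _ ⟨_, rfl⟩; exact ht)
      exact GradedAlgebra.eq_zero_of_eval_eq_zero 𝒜 ha ha0 (fun i ↦ hle (hp i)) h)
  have h3 := (h2.option_iff_transcendental z).2
    (Subalgebra.transcendental_of_eval_eq_zero fun p hp h ↦ by
      have hle : Algebra.adjoin ℂ (Set.range fun o : Option Unit ↦ o.elim a fun _ ↦ t) ≤
          D.kerSubalgebra :=
        Algebra.adjoin_le (by
          rintro _ ⟨_ | _, rfl⟩
          · exact hDa
          · exact hDt)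
      exact D.eq_zero_of_eval_eq_zero hz (fun i ↦ hle (hp i)) h)
  have h4 := h3.lift_cardinalMk_le_trdeg.trans
    (Cardinal.lift_le.2 (Algebra.trdeg_le_of_ringKrullDim_le (k := ℂ) (n := 2) hdim))
  simp only [Cardinal.mk_fintype, Fintype.card_option, Fintype.card_unit,
    Cardinal.lift_natCast] at h4
  exact absurd (Nat.cast_le.1 h4) (by norm_num)

/-- A derivation killing nonzero homogeneous elements of degrees `1` and `-1` and the degree zero
part is zero. -/
theorem GradedAlgebra.derivation_eq_zero {D : Derivation ℂ A A} {a b : A} (ha : a ∈ 𝒜 1)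
    (ha0 : a ≠ 0) (hDa : D a = 0) (hb : b ∈ 𝒜 (-1)) (hb0 : b ≠ 0) (hDb : D b = 0)
    (h : ∀ f ∈ 𝒜 0, D f = 0) : D = 0 := by
  have key {n : ℕ} {f c : A} (hc0 : c ≠ 0) (hDc : D c = 0) (hf : f * c ^ n ∈ 𝒜 0) : D f = 0 := by
    have h1 := h _ hf
    rw [D.leibniz, D.leibniz_pow, hDc] at h1
    simp only [smul_zero, smul_eq_mul, mul_zero, zero_add] at h1
    exact (mul_eq_zero.1 h1).resolve_left (pow_ne_zero _ hc0)
  ext f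
  rw [Derivation.zero_apply]
  induction f using DirectSum.Decomposition.inductionOn 𝒜 with
  | zero => exact map_zero D
  | add f g hf hg => rw [map_add, hf, hg, add_zero]
  | @homogeneous i f =>
    obtain ⟨n, rfl | rfl⟩ := i.eq_nat_or_neg
    · exact key (n := n) hb0 hDb (by
        simpa using SetLike.mul_mem_graded f.2 (SetLike.pow_mem_graded n hb))
    · exact key (n := n) ha0 hDa (by
        simpa using SetLike.mul_mem_graded f.2 (SetLike.pow_mem_graded n ha))

theorem laurentEval_injective {z : A} {u : Aˣ} (hu : (u : A) ∈ 𝒜 1)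
    (hz : ∀ p : ℂ[X], aeval z p ∈ 𝒜 0) (hinj : Function.Injective (aeval z : ℂ[X] →ₐ[ℂ] A)) :
    Function.Injective (laurentEval z u) := by
  rw [injective_iff_map_eq_zero]
  intro f hf
  obtain ⟨n, p, hp⟩ := f.exists_T_pow
  have h1 : laurentEval z u (toLaurent p) = 0 := by rw [hp, map_mul, hf, zero_mul]
  rw [laurentEval_toLaurent] at h1
  have h2 := GradedAlgebra.eq_zero_of_eval_eq_zero 𝒜 hu u.ne_zero
    (fun i ↦ by rw [coeff_map]; exact hz _) h1
  rw [Polynomial.map_eq_zero_iff hinj] at h2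
  rw [h2, map_zero] at hp
  exact ((LaurentPolynomial.isUnit_T (n : ℤ)).mul_left_eq_zero).1 hp.symm

end Graded

/-- Let `A = ⊕_{i ∈ ℤ} A_i` be a hyperbolic (`A_1 ≠ 0 ≠ A_{-1}`) `ℤ`-graded
finitely generated normal domain over `ℂ` of Krull dimension `2`, and `D` a nonzero homogeneous
locally nilpotent `ℂ`-derivation of `A` of degree `0`.  Then there is a `ℂ`-algebra isomorphism
`A ≅ ℂ[z, v, v⁻¹]`, graded with `deg z = 0` and `deg v = d` for some `d ≥ 1`, under which `D`
corresponds to `∂/∂z`.  Here `ℂ[z, v, v⁻¹]` is `LaurentPolynomial (Polynomial ℂ)`, the element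
`C p * T i` corresponds to `p(z)·vⁱ`, and `∂/∂z` sends `C p * T i` to `C p' * T i`. -/
theorem hyperbolic_with_degree_zero_lnd_is_cylinder
    {A : Type*} [CommRing A] [IsDomain A] [Algebra ℂ A] [Algebra.FiniteType ℂ A]
    [IsIntegrallyClosed A]
    (𝒜 : ℤ → Submodule ℂ A) [GradedAlgebra 𝒜]
    (hdim : ringKrullDim A = 2)
    (hA1 : 𝒜 1 ≠ ⊥) (hA1' : 𝒜 (-1) ≠ ⊥)
    (D : Derivation ℂ A A) (hD : D.IsLocallyNilpotent) (hne : D ≠ 0)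
    (hhom : ∀ (n : ℤ), ∀ a ∈ 𝒜 n, D a ∈ 𝒜 n) :
    ∃ (d : ℤ), 1 ≤ d ∧
      ∃ φ : A ≃ₐ[ℂ] LaurentPolynomial (Polynomial ℂ),
        (∀ (i : ℤ) (p : Polynomial ℂ),
          φ.symm (LaurentPolynomial.C p * LaurentPolynomial.T i) ∈ 𝒜 (d * i)) ∧
        (∀ (i : ℤ) (p : Polynomial ℂ),
          φ (D (φ.symm (LaurentPolynomial.C p * LaurentPolynomial.T i))) =
            LaurentPolynomial.C (Polynomial.derivative p) * LaurentPolynomial.T i) := by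
  obtain ⟨a, ha, ha0, hDa⟩ := hD.exists_mem_ne_zero hA1 (hhom 1)
  obtain ⟨b, hb, hb0, hDb⟩ := hD.exists_mem_ne_zero hA1' (hhom (-1))
  obtain ⟨z₀, hz₀, hDz₀, hDDz₀⟩ : ∃ z ∈ 𝒜 0, D z ≠ 0 ∧ D (D z) = 0 := by
    by_contra! h
    refine hne (GradedAlgebra.derivation_eq_zero 𝒜 ha ha0 hDa hb hb0 hDb fun f hf ↦ ?_)
    by_contra hf0
    obtain ⟨z, hz, h1, h2⟩ := hD.exists_localSlice (hhom 0) hf hf0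
    exact h z hz h1 h2
  have hker : ∀ t ∈ 𝒜 0, D t = 0 → ∃ c : ℂ, algebraMap ℂ A c = t := fun t ht hDt ↦
    GradedAlgebra.exists_algebraMap_eq_of_mem_ker 𝒜 hdim.le ha ha0 hDa hDz₀ ht hDt
  obtain ⟨z, hz, hDz⟩ : ∃ z ∈ 𝒜 0, D z = 1 := by
    obtain ⟨c, hc⟩ := hker _ (hhom 0 _ hz₀) hDDz₀
    have hc0 : c ≠ 0 := by
      rintro rfl
      exact hDz₀ (by rw [← hc, map_zero])
    refine ⟨c⁻¹ • z₀, (𝒜 0).smul_mem _ hz₀, ?_⟩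
    rw [D.map_smul, ← hc, Algebra.smul_def, ← map_mul, inv_mul_cancel₀ hc0, map_one]
  obtain ⟨u, rfl, hu'⟩ : ∃ u : Aˣ, (u : A) = a ∧ ((u⁻¹ : Aˣ) : A) ∈ 𝒜 (-1) := by
    obtain ⟨c, hc⟩ := hker (a * b) (by simpa using SetLike.mul_mem_graded ha hb)
      (by rw [D.leibniz, hDa, hDb, smul_zero, smul_zero, add_zero])
    have hc0 : c ≠ 0 := by
      rintro rfl
      exact mul_ne_zero ha0 hb0 (by rw [← hc, map_zero])
    have hab : a * (c⁻¹ • b) = 1 := by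
      rw [mul_smul_comm, ← hc, Algebra.smul_def, ← map_mul, inv_mul_cancel₀ hc0, map_one]
    exact ⟨⟨a, c⁻¹ • b, hab, mul_comm a _ ▸ hab⟩, rfl, (𝒜 (-1)).smul_mem _ hb⟩
  have hzmem (p : ℂ[X]) : aeval z p ∈ 𝒜 0 :=
    Algebra.adjoin_le (S := SetLike.GradeZero.subalgebra 𝒜) (Set.singleton_subset_iff.2 hz)
      (aeval_mem_adjoin_singleton ℂ z)
  have hinj : Function.Injective (aeval z : ℂ[X] →ₐ[ℂ] A) := by
    have : CharZero A := charZero_of_injective_algebraMap (algebraMap ℂ A).injective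
    rw [injective_iff_map_eq_zero]
    intro p hp
    refine (Polynomial.map_eq_zero_iff (algebraMap ℂ A).injective).1
      (D.eq_zero_of_eval_eq_zero (z := z) (by rw [hDz]; exact one_ne_zero) (fun i ↦ ?_) ?_)
    · rw [coeff_map, D.map_algebraMap]
    · rwa [eval_map_algebraMap]
  let ψ := AlgEquiv.ofBijective (laurentEval z u) ⟨laurentEval_injective 𝒜 ha hzmem hinj,
    laurentEval_surjective 𝒜 ha hu' fun f hf ↦ hD.exists_aeval_eq (hhom 0) hker hzmem hDz hf⟩
  have hψ (p : ℂ[X]) (i : ℤ) : ψ (LaurentPolynomial.C p * LaurentPolynomial.T i) =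
      aeval z p * (u ^ i : Aˣ) := laurentEval_C_mul_T z u p i
  refine ⟨1, le_rfl, ψ.symm, fun i p ↦ ?_, fun i p ↦ ?_⟩
  · rw [AlgEquiv.symm_symm, hψ]
    simpa using SetLike.mul_mem_graded (hzmem p) (GradedAlgebra.units_zpow_mem 𝒜 ha hu' i)
  · rw [AlgEquiv.symm_symm, AlgEquiv.symm_apply_eq, hψ, hψ, D.leibniz,
      D.map_units_zpow_eq_zero hDa, D.map_aeval, hDz]
    simp [mul_comm]
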